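/- Let L_2 denote Craig's integral representation of S_4 of rank 3 (the case n = 4, d = 2), and identify ℤ[L_2] with ℤ[x, y, z]. Set f' := 3x² + 8xy + 6y² + 4xz + 6yz + 2z², g' := x³ + 4x²y + 5xy² + 2y³ + 2x²z + 5xyz + 3y²z + xz² + yz², h' := 3x⁴ + 16x³y + 28x²y² + 16xy³ + 8x³z + 28x²yz + 24xy²z + 4x²z² + 8xyz², and k' := (f'² + h')/4. Then k' has coefficients in ℤ and ℤ[L_2]^{S_4} = ℤ[f', g', k'] is a polynomial ring, with f', g', k' algebraically independent over ℤ. -/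

import Mathlib

set_option synthInstance.maxHeartbeats 1000000
set_option maxHeartbeats 1000000

open MvPolynomial

/-- The `(n-1) × (n-1)` rational matrix `E^{i,j}` (1-based indices `i`, `j`) whose
`(i,j)`-entry is `1` and all other entries are `0`; it is the zero matrix when `i` or `j`
is out of the range `1, …, n-1`. -/
def Emat (n i j : ℕ) : Matrix (Fin (n - 1)) (Fin (n - 1)) ℚ :=
  Matrix.of fun a b => if (a : ℕ) + 1 = i ∧ (b : ℕ) + 1 = j then 1 else 0

/-- `F_k = I_{n-1} + E^{n-k-1,n-k} - 2 E^{n-k,n-k} + E^{n-k+1,n-k}`. -/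
def Fmat (n k : ℕ) : Matrix (Fin (n - 1)) (Fin (n - 1)) ℚ :=
  1 + Emat n (n - k - 1) (n - k) - 2 • Emat n (n - k) (n - k) + Emat n (n - k + 1) (n - k)

/-- `V_d = d E^{1,1} + ∑_{i=2}^{n-1} (E^{i,i} + (n-i) E^{1,i})`. -/
def Vmat (n d : ℕ) : Matrix (Fin (n - 1)) (Fin (n - 1)) ℚ :=
  d • Emat n 1 1 + ∑ i ∈ Finset.Icc 2 (n - 1), (Emat n i i + (n - i) • Emat n 1 i)

/-- The image of Craig's representation `L_d` of `S_n`: the subgroup of `GL_{n-1}(ℚ)`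
generated by the images `V_d⁻¹ F_k V_d` of the adjacent transpositions `(k, k+1)`. -/
noncomputable def craigGroup (n d : ℕ) : Subgroup (GL (Fin (n - 1)) ℚ) :=
  Subgroup.closure {g | ∃ k, 1 ≤ k ∧ k ≤ n - 1 ∧
    (g : Matrix (Fin (n - 1)) (Fin (n - 1)) ℚ) = (Vmat n d)⁻¹ * Fmat n k * Vmat n d}

/-- The algebra endomorphism of `ℚ[x_1, …, x_m]` given by the linear substitution
`x_i ↦ ∑_j M_{i,j} x_j` for a matrix `M`. -/
noncomputable def actQ {m : ℕ} (M : Matrix (Fin m) (Fin m) ℚ) :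
    MvPolynomial (Fin m) ℚ →ₐ[ℚ] MvPolynomial (Fin m) ℚ :=
  aeval fun i => ∑ j, C (M i j) * X j

/-- For a subring `R ⊆ ℚ` and a subgroup `G ⊆ GL_m(ℚ)`, the invariant ring `R[x_1, …, x_m]^G`:
the `R`-subalgebra of `ℚ[x_1, …, x_m]` consisting of the polynomials with all coefficients
in `R` that are fixed by the substitution action of every element of `G`. -/
noncomputable def invariantRingQ {m : ℕ} (R : Subring ℚ) (G : Subgroup (GL (Fin m) ℚ)) :
    Subalgebra ↥R (MvPolynomial (Fin m) ℚ) :=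
  (MvPolynomial.mapAlgHom (R := ↥R) (σ := Fin m) (Algebra.ofId ↥R ℚ)).range ⊓
    Subalgebra.restrictScalars ↥R
      (⨅ g ∈ G, AlgHom.equalizer (actQ (g : Matrix (Fin m) (Fin m) ℚ)) (AlgHom.id ℚ _))

/-- `R[x_1, …, x_m]^G` is isomorphic to a polynomial ring over `R`. -/
def IsPolynomialRingQ {m : ℕ} (R : Subring ℚ) (G : Subgroup (GL (Fin m) ℚ)) : Prop :=
  ∃ k : ℕ, Nonempty (↥(invariantRingQ R G) ≃ₐ[↥R] MvPolynomial (Fin k) ↥R)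

/-- For a subgroup `G ⊆ GL_m(ℚ)`, the invariant ring `ℤ[x_1, …, x_m]^G`: the
`ℤ`-subalgebra of `ℚ[x_1, …, x_m]` consisting of the polynomials with all coefficients
in `ℤ` that are fixed by the substitution action of every element of `G`. -/
noncomputable def invariantRingZ {m : ℕ} (G : Subgroup (GL (Fin m) ℚ)) :
    Subalgebra ℤ (MvPolynomial (Fin m) ℚ) :=
  (MvPolynomial.mapAlgHom (R := ℤ) (σ := Fin m) (Algebra.ofId ℤ ℚ)).range ⊓
    Subalgebra.restrictScalars ℤ
      (⨅ g ∈ G, AlgHom.equalizer (actQ (g : Matrix (Fin m) (Fin m) ℚ)) (AlgHom.id ℚ _))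

noncomputable def xP : MvPolynomial (Fin (4 - 1)) ℚ := X ⟨0, by omega⟩
noncomputable def yP : MvPolynomial (Fin (4 - 1)) ℚ := X ⟨1, by omega⟩
noncomputable def zP : MvPolynomial (Fin (4 - 1)) ℚ := X ⟨2, by omega⟩

noncomputable def f'P : MvPolynomial (Fin (4 - 1)) ℚ :=
  3*xP^2 + 8*xP*yP + 6*yP^2 + 4*xP*zP + 6*yP*zP + 2*zP^2
noncomputable def g'P : MvPolynomial (Fin (4 - 1)) ℚ :=
  xP^3 + 4*xP^2*yP + 5*xP*yP^2 + 2*yP^3 + 2*xP^2*zP + 5*xP*yP*zP + 3*yP^2*zP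
    + xP*zP^2 + yP*zP^2
noncomputable def h'P : MvPolynomial (Fin (4 - 1)) ℚ :=
  3*xP^4 + 16*xP^3*yP + 28*xP^2*yP^2 + 16*xP*yP^3 + 8*xP^3*zP + 28*xP^2*yP*zP
    + 24*xP*yP^2*zP + 4*xP^2*zP^2 + 8*xP*yP*zP^2
noncomputable def k'P : MvPolynomial (Fin (4 - 1)) ℚ := C (1/4 : ℚ) * (f'P^2 + h'P)

namespace MvPolynomial

/-- The polynomial whose coefficient at `m` is the coefficient of `p` at `2 • m + c`. -/
noncomputable def contractTwo {σ R : Type*} [CommSemiring R] (c : σ →₀ ℕ)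
    (p : MvPolynomial σ R) : MvPolynomial σ R :=
  AddMonoidAlgebra.ofCoeff <| (AddMonoidAlgebra.coeff p).comapDomain (fun m => 2 • m + c)
    (fun a _ b _ h => by
      ext i
      have := DFunLike.congr_fun h i
      simp at this
      exact this)

lemma coeff_contractTwo {σ R : Type*} [CommSemiring R] (c m : σ →₀ ℕ) (p : MvPolynomial σ R) :
    coeff m (contractTwo c p) = coeff (2 • m + c) p := rfl

lemma IsSymmetric.contractTwo {σ R : Type*} [CommSemiring R] {c : σ →₀ ℕ}
    {p : MvPolynomial σ R} (hp : p.IsSymmetric) (hc : ∀ e : Equiv.Perm σ, c.mapDomain e = c) :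
    (contractTwo c p).IsSymmetric := by
  intro e
  ext m
  obtain ⟨n, rfl⟩ : ∃ n, Finsupp.mapDomain e n = m :=
    ⟨m.mapDomain e.symm, by rw [← Finsupp.mapDomain_comp]; simp⟩
  rw [coeff_rename_mapDomain _ e.injective, coeff_contractTwo, coeff_contractTwo,
    ← coeff_rename_mapDomain _ e.injective, hp e, Finsupp.mapDomain_add, hc,
    Finsupp.mapDomain_smul]

lemma coeff_aeval_C_mul_X {σ R : Type*} [Fintype σ] [CommSemiring R] (s : σ → R)
    (p : MvPolynomial σ R) (m : σ →₀ ℕ) :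
    coeff m (aeval (fun i => C (s i) * X i) p) = (∏ i, s i ^ m i) * coeff m p := by
  classical
  induction p using MvPolynomial.induction_on' with
  | monomial n a =>
    have : aeval (fun i => C (s i) * X i) (monomial n a) = C (∏ i, s i ^ n i) * monomial n a := by
      rw [aeval_monomial, Finsupp.prod_fintype _ _ (by simp)]
      simp_rw [mul_pow]
      rw [Finset.prod_mul_distrib, monomial_eq, Finsupp.prod_fintype _ _ (by simp)]
      simp only [map_prod, map_pow, algebraMap_eq]
      ring
    rw [this, coeff_C_mul, coeff_monomial]
    split_ifs with h
    · rw [h]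
    · simp
  | add p q hp hq => simp only [map_add, coeff_add, hp, hq, mul_add]

/-- The exponent vector `(1, 1, 1)`. -/
noncomputable def onesExp : Fin 3 →₀ ℕ := Finsupp.equivFunOnFinite.symm fun _ => 1

@[simp] lemma onesExp_apply (i : Fin 3) : onesExp i = 1 := rfl

lemma monomial_onesExp : monomial onesExp (1 : ℤ) = X 0 * X 1 * X 2 := by
  rw [monomial_eq, Finsupp.prod_fintype _ _ (by simp)]
  simp [Fin.prod_univ_three]

lemma mapDomain_onesExp (e : Equiv.Perm (Fin 3)) : onesExp.mapDomain e = onesExp := by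
  ext i
  obtain ⟨j, rfl⟩ := e.surjective i
  rw [Finsupp.mapDomain_apply e.injective]
  simp

lemma eq_expand_contractTwo_add {p : MvPolynomial (Fin 3) ℤ}
    (h01 : ∀ m, coeff m p ≠ 0 → (m 0 + m 1) % 2 = 0)
    (h02 : ∀ m, coeff m p ≠ 0 → (m 0 + m 2) % 2 = 0) :
    p = expand 2 (contractTwo 0 p) + X 0 * X 1 * X 2 * expand 2 (contractTwo onesExp p) := by
  rw [← monomial_onesExp]
  ext m
  rw [coeff_add, coeff_monomial_mul', one_mul]
  by_cases hm : coeff m p = 0 ∨ ((m 0 + m 1) % 2 = 0 ∧ (m 0 + m 2) % 2 = 0)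
  swap
  · push Not at hm
    exact absurd (h02 m hm.1) (hm.2 (h01 m hm.1))
  by_cases he : ∀ i, 2 ∣ m i
  · choose n hn using he
    obtain rfl : m = 2 • Finsupp.equivFunOnFinite.symm n := by ext i; simp [hn]
    rw [coeff_expand_smul _ two_ne_zero, coeff_contractTwo, add_zero]
    split_ifs with h
    · rw [coeff_expand_of_not_dvd (i := 0), add_zero]
      have := h 0
      simp at this ⊢
      omega
    · simp
  by_cases ho : ∀ i, m i % 2 = 1
  · obtain ⟨n, rfl⟩ : ∃ n, m = 2 • n + onesExp :=
      ⟨Finsupp.equivFunOnFinite.symm fun i => m i / 2, by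
        ext i; have := ho i; simp; omega⟩
    rw [coeff_expand_of_not_dvd (i := 0), if_pos (by simp), add_tsub_cancel_right,
      coeff_expand_smul _ two_ne_zero, coeff_contractTwo, zero_add]
    have := ho 0
    omega
  · push Not at he ho
    obtain ⟨i, hi⟩ := he
    obtain ⟨j, hj⟩ := ho
    have hp : coeff m p = 0 := by
      refine hm.resolve_right fun h => ?_
      fin_cases i <;> fin_cases j <;> simp at hi hj <;> omega
    rw [hp, coeff_expand_of_not_dvd _ hi]
    split_ifs with h
    · rw [coeff_expand_of_not_dvd (i := j), add_zero]
      have := h j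
      simp at this ⊢
      omega
    · simp

end MvPolynomial

namespace Craig

/-- The sum of squares of the variables. -/
noncomputable def invF : MvPolynomial (Fin 3) ℤ := X 0 ^ 2 + X 1 ^ 2 + X 2 ^ 2
/-- The product of the variables. -/
noncomputable def invG : MvPolynomial (Fin 3) ℤ := X 0 * X 1 * X 2
/-- The second elementary symmetric polynomial in the squares of the variables. -/
noncomputable def invK : MvPolynomial (Fin 3) ℤ :=
  X 0 ^ 2 * X 1 ^ 2 + X 0 ^ 2 * X 2 ^ 2 + X 1 ^ 2 * X 2 ^ 2

/-- The action of the `k`-th adjacent transposition in coordinates which it permutes up to sign. -/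
noncomputable def signedPerm (k : Fin 3) : MvPolynomial (Fin 3) ℤ →ₐ[ℤ] MvPolynomial (Fin 3) ℤ :=
  ![aeval ![X 2, X 1, X 0], aeval ![X 0, X 2, X 1], aeval ![-X 2, X 1, -X 0]] k

lemma esymm_two : esymm (Fin 3) ℤ 2 = X 0 * X 1 + X 0 * X 2 + X 1 * X 2 := by
  have : (Finset.powersetCard 2 (Finset.univ : Finset (Fin 3))) = {{0, 1}, {0, 2}, {1, 2}} := by
    decide
  rw [esymm, this, Finset.sum_insert (by decide), Finset.sum_insert (by decide),
    Finset.sum_singleton, Finset.prod_pair (by decide), Finset.prod_pair (by decide),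
    Finset.prod_pair (by decide)]
  ring

lemma esymm_three : esymm (Fin 3) ℤ 3 = X 0 * X 1 * X 2 := by
  have : (Finset.powersetCard 3 (Finset.univ : Finset (Fin 3))) = {Finset.univ} := by
    decide
  rw [esymm, this, Finset.sum_singleton, Fin.prod_univ_three]

lemma expand_mem_adjoin {p : MvPolynomial (Fin 3) ℤ} (hp : p.IsSymmetric) :
    expand 2 p ∈ Algebra.adjoin ℤ {invF, invG, invK} := by
  obtain ⟨q, hq⟩ := esymmAlgHom_surjective (σ := Fin 3) (n := 3) ℤ (by simp) ⟨p, hp⟩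
  have hpq := congrArg Subtype.val hq
  rw [esymmAlgHom_apply] at hpq
  change _ = p at hpq
  rw [← hpq, ← AlgHom.comp_apply, comp_aeval]
  refine (Algebra.adjoin_range_eq_range_aeval ℤ _).ge.trans (Algebra.adjoin_le ?_) ⟨q, rfl⟩
  rintro _ ⟨i, rfl⟩
  fin_cases i
  · have : expand 2 (esymm (Fin 3) ℤ 1) = invF := by
      simp [invF, Fin.sum_univ_three]
    exact this ▸ Algebra.subset_adjoin (by simp)
  · have : expand 2 (esymm (Fin 3) ℤ 2) = invK := by
      simp [invK, esymm_two]
    exact this ▸ Algebra.subset_adjoin (by simp)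
  · have : expand 2 (esymm (Fin 3) ℤ 3) = invG ^ 2 := by
      simp [invG, esymm_three, mul_pow]
    change expand 2 (esymm (Fin 3) ℤ 3) ∈ Algebra.adjoin ℤ _
    exact this ▸ pow_mem (Algebra.subset_adjoin (by simp)) 2

lemma isSymmetric_of_swap {p : MvPolynomial (Fin 3) ℤ} (h02 : signedPerm 0 p = p)
    (h12 : signedPerm 1 p = p) : p.IsSymmetric := by
  have r02 : rename (Equiv.swap (0 : Fin 3) 2) p = p := by
    have : rename (Equiv.swap (0 : Fin 3) 2) = signedPerm 0 := by
      ext i : 1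
      fin_cases i <;> simp [signedPerm, Equiv.swap_apply_def]
    rw [this, h02]
  have r12 : rename (Equiv.swap (1 : Fin 3) 2) p = p := by
    have : rename (Equiv.swap (1 : Fin 3) 2) = signedPerm 1 := by
      ext i : 1
      fin_cases i <;> simp [signedPerm, Equiv.swap_apply_def]
    rw [this, h12]
  have key : ∀ e f : Equiv.Perm (Fin 3), rename e p = p → rename f p = p →
      rename (e * f) p = p := by
    intro e f he hf
    rw [Equiv.Perm.coe_mul, ← rename_rename, hf, he]
  intro e
  have : e = 1 ∨ e = Equiv.swap 0 2 ∨ e = Equiv.swap 1 2 ∨ e = Equiv.swap 0 2 * Equiv.swap 1 2 ∨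
      e = Equiv.swap 1 2 * Equiv.swap 0 2 ∨
      e = Equiv.swap 0 2 * (Equiv.swap 1 2 * Equiv.swap 0 2) := by
    revert e
    decide
  rcases this with rfl | rfl | rfl | rfl | rfl | rfl
  · simp
  · exact r02
  · exact r12
  · exact key _ _ r02 r12
  · exact key _ _ r12 r02
  · exact key _ _ r02 (key _ _ r12 r02)

lemma coeff_parity {p : MvPolynomial (Fin 3) ℤ} (s : Fin 3 → ℤ)
    (h : aeval (fun i => C (s i) * X i) p = p) (m : Fin 3 →₀ ℕ) (hm : coeff m p ≠ 0) :
    s 0 ^ m 0 * s 1 ^ m 1 * s 2 ^ m 2 = 1 := by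
  have := coeff_aeval_C_mul_X s p m
  rw [h, Fin.prod_univ_three] at this
  exact mul_right_cancel₀ hm (by rw [← this, one_mul])

lemma mod_two_of_neg_one_pow {n : ℕ} (h : (-1 : ℤ) ^ n = 1) : n % 2 = 0 := by
  rcases Nat.even_or_odd n with hn | hn
  · exact Nat.even_iff.mp hn
  · rw [hn.neg_one_pow] at h
    norm_num at h

lemma mem_adjoin_of_signedPerm {p : MvPolynomial (Fin 3) ℤ} (hp : ∀ k, signedPerm k p = p) :
    p ∈ Algebra.adjoin ℤ {invF, invG, invK} := by
  have hs := isSymmetric_of_swap (hp 0) (hp 1)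
  have t02 : aeval (fun i => C (![-1, 1, -1] i) * X i) p = p := by
    have : aeval (fun i => C (![-1, 1, -1] i) * X i) = (signedPerm 0).comp (signedPerm 2) := by
      ext i : 1
      fin_cases i <;> simp [signedPerm]
    rw [this, AlgHom.comp_apply, hp, hp]
  have t01 : aeval (fun i => C (![-1, -1, 1] i) * X i) p = p := by
    have : aeval (fun i => C (![-1, -1, 1] i) * X i) = (signedPerm 1).comp
        (((signedPerm 0).comp (signedPerm 2)).comp (signedPerm 1)) := by
      ext i : 1
      fin_cases i <;> simp [signedPerm]
    rw [this]
    simp only [AlgHom.comp_apply, hp]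
  rw [eq_expand_contractTwo_add (p := p)
    (fun m hm => mod_two_of_neg_one_pow (by simpa [pow_add] using coeff_parity _ t01 m hm))
    (fun m hm => mod_two_of_neg_one_pow (by simpa [pow_add] using coeff_parity _ t02 m hm))]
  exact add_mem (expand_mem_adjoin (hs.contractTwo (by simp)))
    (mul_mem (Algebra.subset_adjoin (by simp [invG]))
      (expand_mem_adjoin (hs.contractTwo mapDomain_onesExp)))

lemma signedPerm_invariants (k : Fin 3) : signedPerm k invF = invF ∧ signedPerm k invG = invG ∧
    signedPerm k invK = invK := by
  fin_cases k <;> simp [signedPerm, invF, invG, invK] <;> refine ⟨?_, ?_, ?_⟩ <;> ring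

lemma isAlgebraic_X (i : Fin 3) :
    IsAlgebraic (Algebra.adjoin ℤ (Set.range ![invF, invG, invK])) (X i : MvPolynomial (Fin 3) ℤ) := by
  set S := Algebra.adjoin ℤ (Set.range ![invF, invG, invK])
  have hF : invF ∈ S := Algebra.subset_adjoin ⟨0, rfl⟩
  have hG : invG ∈ S := Algebra.subset_adjoin ⟨1, rfl⟩
  have hK : invK ∈ S := Algebra.subset_adjoin ⟨2, rfl⟩
  refine IsAlgebraic.of_pow two_pos (IsIntegral.isAlgebraic
    ⟨Polynomial.X ^ 3 - Polynomial.C ⟨_, hF⟩ * Polynomial.X ^ 2 + Polynomial.C ⟨_, hK⟩ * Polynomial.X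
      - Polynomial.C (⟨_, hG⟩ ^ 2), by monicity!, ?_⟩)
  simp only [Polynomial.eval₂_add, Polynomial.eval₂_sub, Polynomial.eval₂_mul, Polynomial.eval₂_pow,
    Polynomial.eval₂_X, Polynomial.eval₂_C, map_pow, Subalgebra.algebraMap_def]
  fin_cases i <;> simp [invF, invG, invK] <;> ring

lemma algebraicIndependent_invariants : AlgebraicIndependent ℤ ![invF, invG, invK] := by
  have : Algebra.IsAlgebraic (Algebra.adjoin ℤ (Set.range ![invF, invG, invK]))
      (MvPolynomial (Fin 3) ℤ) := by
    refine ⟨fun p => ?_⟩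
    induction p using MvPolynomial.induction_on with
    | C a => exact isAlgebraic_algebraMap (algebraMap ℤ _ a)
    | add p q hp hq => exact hp.add hq
    | mul_X p i hp => exact hp.mul (isAlgebraic_X i)
  exact (Algebra.IsAlgebraic.isTranscendenceBasis_of_le_trdeg_of_finite ℤ _ (by simp)).1

/-- The linear change of variables to coordinates permuted up to sign by `craigGroup 4 2`. -/
noncomputable def coordHom : MvPolynomial (Fin 3) ℤ →ₐ[ℤ] MvPolynomial (Fin (4 - 1)) ℚ :=
  aeval ![xP + yP, xP + (yP + yP) + zP, xP + yP + zP]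

/-- The integral form of `coordHom`. -/
noncomputable def coordHomInt : MvPolynomial (Fin 3) ℤ →ₐ[ℤ] MvPolynomial (Fin (4 - 1)) ℤ :=
  aeval ![X 0 + X 1, X 0 + (X 1 + X 1) + X 2, X 0 + X 1 + X 2]

/-- The inverse of `coordHomInt`. -/
noncomputable def coordHomInv : MvPolynomial (Fin (4 - 1)) ℤ →ₐ[ℤ] MvPolynomial (Fin 3) ℤ :=
  aeval ![X 0 - X 1 + X 2, X 1 - X 2, X 2 - X 0]

/-- The inclusion of `ℤ[x, y, z]` in `ℚ[x, y, z]`. -/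
noncomputable abbrev inclHom : MvPolynomial (Fin (4 - 1)) ℤ →ₐ[ℤ] MvPolynomial (Fin (4 - 1)) ℚ :=
  MvPolynomial.mapAlgHom (Algebra.ofId ℤ ℚ)

lemma inclHom_comp_coordHomInt : inclHom.comp coordHomInt = coordHom := by
  ext i : 1
  fin_cases i <;> simp [coordHomInt, coordHom, xP, yP, zP]

lemma coordHom_comp_coordHomInv : coordHom.comp coordHomInv = inclHom := by
  ext i : 1
  fin_cases i <;> simp [coordHomInv, coordHom, xP, yP, zP]
  ring

lemma coordHomInv_comp_coordHomInt : coordHomInv.comp coordHomInt = AlgHom.id ℤ _ := by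
  ext i : 1
  fin_cases i <;> simp [coordHomInv, coordHomInt]
  ring

lemma inclHom_injective : Function.Injective inclHom :=
  MvPolynomial.map_injective _ Int.cast_injective

lemma coordHom_injective : Function.Injective coordHom := by
  rw [← inclHom_comp_coordHomInt]
  refine inclHom_injective.comp (Function.LeftInverse.injective (g := coordHomInv) fun p => ?_)
  exact DFunLike.congr_fun coordHomInv_comp_coordHomInt p

lemma range_coordHom : coordHom.range = inclHom.range := by
  refine le_antisymm ?_ ?_
  · rw [← inclHom_comp_coordHomInt]
    exact AlgHom.range_comp_le_range _ _
  · rw [← coordHom_comp_coordHomInv]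
    exact AlgHom.range_comp_le_range _ _

lemma coordHom_invF : coordHom invF = f'P := by
  simp [coordHom, invF, f'P]
  ring

lemma coordHom_invG : coordHom invG = g'P := by
  simp [coordHom, invG, g'P]
  ring

lemma coordHom_invK : coordHom invK = k'P := by
  have h : (C (1 / 4 : ℚ) : MvPolynomial (Fin (4 - 1)) ℚ) * 4 = 1 := by
    rw [show (4 : MvPolynomial (Fin (4 - 1)) ℚ) = C 4 from rfl, ← C_mul]
    norm_num
  have h4 : f'P ^ 2 + h'P = 4 * coordHom invK := by
    simp [coordHom, invK, f'P, h'P]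
    ring
  rw [k'P, h4, ← mul_assoc, h, one_mul]

/-- The matrices `V_2⁻¹ F_k V_2` for `k = 1, 2, 3`. -/
def genMat (k : Fin 3) : Matrix (Fin (4 - 1)) (Fin (4 - 1)) ℚ :=
  ![!![1, 0, 0; 0, 1, 1; 0, 0, -1], !![1, 2, 0; 0, -1, 0; 0, 1, 1],
    !![-3, -4, -2; 2, 3, 1; 0, 0, 1]] k

lemma Vmat_four_two : Vmat 4 2 = !![2, 2, 1; 0, 1, 0; 0, 0, 1] := by
  ext i j
  fin_cases i <;> fin_cases j <;>
    simp [Vmat, Emat, Finset.sum_Icc_succ_top]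

lemma inv_Vmat_four_two : (Vmat 4 2)⁻¹ = !![1 / 2, -1, -1 / 2; 0, 1, 0; 0, 0, 1] := by
  refine Matrix.inv_eq_right_inv ?_
  rw [Vmat_four_two]
  ext i j
  fin_cases i <;> fin_cases j <;> simp [Matrix.mul_apply, Fin.sum_univ_three]
  norm_num

lemma Fmat_four (k : Fin 3) : Fmat 4 (k + 1) =
    ![!![1, 0, 0; 0, 1, 1; 0, 0, -1], !![1, 1, 0; 0, -1, 0; 0, 1, 1],
      !![-1, 0, 0; 1, 1, 0; 0, 0, 1]] k := by
  ext i j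
  fin_cases k <;> fin_cases i <;> fin_cases j <;>
    norm_num [Fmat, Emat, Matrix.one_apply, Matrix.add_apply, Matrix.sub_apply, Matrix.smul_apply]

lemma conj_Fmat (k : Fin 3) : (Vmat 4 2)⁻¹ * Fmat 4 (k + 1) * Vmat 4 2 = genMat k := by
  rw [inv_Vmat_four_two, Vmat_four_two, Fmat_four]
  ext i j
  fin_cases k <;> fin_cases i <;> fin_cases j <;>
    simp [genMat, Matrix.mul_apply, Fin.sum_univ_three] <;> norm_num

lemma genMat_mul_self (k : Fin 3) : genMat k * genMat k = 1 := by
  ext i j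
  fin_cases k <;> fin_cases i <;> fin_cases j <;>
    simp [genMat, Matrix.mul_apply, Fin.sum_univ_three] <;> norm_num

lemma exists_mem_craigGroup (k : Fin 3) : ∃ g ∈ craigGroup 4 2,
    (g : Matrix (Fin (4 - 1)) (Fin (4 - 1)) ℚ) = genMat k :=
  ⟨⟨genMat k, genMat k, genMat_mul_self k, genMat_mul_self k⟩,
    Subgroup.subset_closure ⟨k + 1, by omega, by omega, (conj_Fmat k).symm⟩, rfl⟩

lemma actQ_genMat (k : Fin 3) (p : MvPolynomial (Fin 3) ℤ) :
    actQ (genMat k) (coordHom p) = coordHom (signedPerm k p) := by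
  have hact (M : Matrix (Fin (4 - 1)) (Fin (4 - 1)) ℚ) (i : Fin (4 - 1)) :
      actQ M (X i) = C (M i 0) * X 0 + C (M i 1) * X 1 + C (M i 2) * X 2 := by
    rw [actQ, aeval_X]
    exact Fin.sum_univ_three _
  have : ((actQ (genMat k)).restrictScalars ℤ).comp coordHom = coordHom.comp (signedPerm k) := by
    have h2 : (C 2 : MvPolynomial (Fin (4 - 1)) ℚ) = 2 := rfl
    have h3 : (C 3 : MvPolynomial (Fin (4 - 1)) ℚ) = 3 := rfl
    have h4 : (C 4 : MvPolynomial (Fin (4 - 1)) ℚ) = 4 := rfl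
    ext i : 1
    fin_cases k <;> fin_cases i <;>
      simp [hact, genMat, coordHom, signedPerm, xP, yP, zP, h2, h3, h4] <;> ring
  exact DFunLike.congr_fun this p

lemma actQ_one {m : ℕ} : actQ (1 : Matrix (Fin m) (Fin m) ℚ) = AlgHom.id ℚ _ := by
  ext i : 1
  simp [actQ, Matrix.one_apply]

lemma actQ_mul {m : ℕ} (M N : Matrix (Fin m) (Fin m) ℚ) :
    actQ (M * N) = (actQ N).comp (actQ M) := by
  ext i : 1
  simp only [actQ, aeval_X, AlgHom.comp_apply, map_sum, map_mul, Matrix.mul_apply, Finset.sum_mul,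
    Finset.mul_sum, algHom_C, algebraMap_eq]
  rw [Finset.sum_comm]
  simp only [mul_assoc]

lemma actQ_eq_self_of_genMat {p : MvPolynomial (Fin (4 - 1)) ℚ}
    (hp : ∀ k, actQ (genMat k) p = p) {g : GL (Fin (4 - 1)) ℚ} (hg : g ∈ craigGroup 4 2) :
    actQ (g : Matrix (Fin (4 - 1)) (Fin (4 - 1)) ℚ) p = p := by
  induction hg using Subgroup.closure_induction with
  | mem g hg =>
    obtain ⟨k, h1, h3, hk⟩ := hg
    obtain ⟨j, rfl⟩ : ∃ j : Fin 3, k = j + 1 := ⟨⟨k - 1, by omega⟩, by simp; omega⟩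
    rw [hk, conj_Fmat, hp]
  | one => rw [Units.val_one, actQ_one, AlgHom.id_apply]
  | mul g h _ _ hg hh => rw [Units.val_mul, actQ_mul, AlgHom.comp_apply, hg, hh]
  | inv g _ hg =>
    conv_lhs => rw [← hg]
    rw [← AlgHom.comp_apply, ← actQ_mul, ← Units.val_mul, mul_inv_cancel, Units.val_one, actQ_one,
      AlgHom.id_apply]

lemma mem_invariantRingZ {m : ℕ} {G : Subgroup (GL (Fin m) ℚ)} {p : MvPolynomial (Fin m) ℚ} :
    p ∈ invariantRingZ G ↔ p ∈ (MvPolynomial.mapAlgHom (R := ℤ) (σ := Fin m)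
      (Algebra.ofId ℤ ℚ)).range ∧
      ∀ g ∈ G, actQ (g : Matrix (Fin m) (Fin m) ℚ) p = p := by
  simp [invariantRingZ, Algebra.mem_inf, Algebra.mem_iInf, AlgHom.mem_equalizer]

lemma coordHom_mem_invariantRingZ {p : MvPolynomial (Fin 3) ℤ} :
    coordHom p ∈ invariantRingZ (craigGroup 4 2) ↔ ∀ k, signedPerm k p = p := by
  rw [mem_invariantRingZ]
  refine ⟨fun h k => ?_, fun h => ⟨?_, fun g hg => actQ_eq_self_of_genMat (fun k => ?_) hg⟩⟩
  · obtain ⟨g, hg, hk⟩ := exists_mem_craigGroup k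
    exact coordHom_injective (by rw [← actQ_genMat, ← hk, h.2 g hg])
  · exact range_coordHom.le ⟨p, rfl⟩
  · rw [actQ_genMat, h]

lemma invariantRingZ_craigGroup :
    invariantRingZ (craigGroup 4 2) = Algebra.adjoin ℤ {f'P, g'P, k'P} := by
  refine le_antisymm (fun p hp => ?_) (Algebra.adjoin_le ?_)
  · obtain ⟨q, rfl⟩ := range_coordHom.ge (mem_invariantRingZ.mp hp).1
    have : coordHom q ∈ (Algebra.adjoin ℤ {invF, invG, invK}).map coordHom :=
      ⟨q, mem_adjoin_of_signedPerm (coordHom_mem_invariantRingZ.mp hp), rfl⟩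
    rw [AlgHom.map_adjoin, Set.image_insert_eq, Set.image_pair, coordHom_invF, coordHom_invG,
      coordHom_invK] at this
    exact this
  · rintro p (rfl | rfl | rfl)
    · exact coordHom_invF ▸ coordHom_mem_invariantRingZ.mpr fun k => (signedPerm_invariants k).1
    · exact coordHom_invG ▸ coordHom_mem_invariantRingZ.mpr fun k => (signedPerm_invariants k).2.1
    · exact coordHom_invK ▸ coordHom_mem_invariantRingZ.mpr fun k => (signedPerm_invariants k).2.2

lemma algebraicIndependent_craig : AlgebraicIndependent ℤ ![f'P, g'P, k'P] := by
  convert! algebraicIndependent_invariants.map' coordHom_injective using 1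
  ext1 i
  fin_cases i
  exacts [coordHom_invF.symm, coordHom_invG.symm, coordHom_invK.symm]

end Craig

/-- for Craig's representation `L_2` of `S_4` (the case `n = 4`, `d = 2`),
the polynomial `k' = (f'² + h')/4` has integer coefficients, and
`ℤ[L_2]^{S_4} = ℤ[f', g', k']` is a polynomial ring, with `f'`, `g'`, `k'`
algebraically independent over `ℤ`. -/
theorem craig_L2_S4_invariants :
    (∀ m : Fin (4 - 1) →₀ ℕ, MvPolynomial.coeff m k'P ∈ Set.range ((↑) : ℤ → ℚ)) ∧
    invariantRingZ (craigGroup 4 2) = Algebra.adjoin ℤ {f'P, g'P, k'P} ∧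
    AlgebraicIndependent ℤ ![f'P, g'P, k'P] ∧
    ∃ k : ℕ, Nonempty (↥(invariantRingZ (craigGroup 4 2)) ≃ₐ[ℤ] MvPolynomial (Fin k) ℤ) := by
  have hmem : k'P ∈ invariantRingZ (craigGroup 4 2) := by
    rw [Craig.invariantRingZ_craigGroup]
    exact Algebra.subset_adjoin (by simp)
  refine ⟨fun m => ?_, Craig.invariantRingZ_craigGroup, Craig.algebraicIndependent_craig, 3, ?_⟩
  · obtain ⟨q, hq⟩ := (Craig.mem_invariantRingZ.mp hmem).1
    exact ⟨coeff m q, by rw [← hq]; exact (coeff_map (Int.castRingHom ℚ) q m).symm⟩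
  · have hrange : invariantRingZ (craigGroup 4 2) =
        Algebra.adjoin ℤ (Set.range ![f'P, g'P, k'P]) := by
      rw [Craig.invariantRingZ_craigGroup, Matrix.range_cons, Matrix.range_cons,
        Matrix.range_cons, Matrix.range_empty, Set.union_empty, Set.singleton_union,
        Set.singleton_union]
    rw [hrange]
    exact ⟨Craig.algebraicIndependent_craig.aevalEquiv.symm⟩
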